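/- arXiv:2508.18198 — 4 statements merged into one kernel-verified Lean document; each statement's English description precedes it below -/
import Mathlib

section
/- Let E and F be complete nonarchimedean normed additive commutative groups (the norms satisfy ‖x+y‖ ≤ max(‖x‖,‖y‖)). Let c be a real number with 0 < c < 1, and let σ : E → E and τ : F → F be additive group automorphisms satisfying ‖σ(x)‖ = c·‖x‖ for all x ∈ E and ‖τ(y)‖ = c·‖y‖ for all y ∈ F. Let T : E → F be a continuous surjective additive group homomorphism with T(σ(x)) = τ(T(x)) for all x ∈ E. Then T is an open map. -/
open Filter Topology

/-- By Baire's theorem, a surjective homomorphism onto a complete group sends some ball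
to a set approximating every point of some `δ`-ball up to `c * δ`. -/
lemma exists_approx_preimage_of_surjective {E F : Type*} [NormedAddCommGroup E]
    [NormedAddCommGroup F] [CompleteSpace F] {c : ℝ} (hc0 : 0 < c)
    (T : E →+ F) (hT : Function.Surjective T) :
    ∃ δ > 0, ∃ R : ℝ, ∀ y : F, ‖y‖ < δ → ∃ x : E, ‖x‖ ≤ R ∧ ‖y - T x‖ < c * δ := by
  have hcover : ⋃ n : ℕ, closure (T '' Metric.closedBall 0 (n : ℝ)) = Set.univ := by
    refine Set.eq_univ_of_forall fun y => ?_
    obtain ⟨x, rfl⟩ := hT y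
    obtain ⟨n, hn⟩ := exists_nat_ge ‖x‖
    exact Set.mem_iUnion.2 ⟨n, subset_closure ⟨x, by simpa using hn, rfl⟩⟩
  obtain ⟨n, y₀, hy₀⟩ := nonempty_interior_of_iUnion_of_closed (fun _ => isClosed_closure) hcover
  obtain ⟨δ, hδ, hball⟩ := Metric.isOpen_iff.1 isOpen_interior y₀ hy₀
  refine ⟨δ, hδ, n + n, fun y hy => ?_⟩
  have approx : ∀ z ∈ Metric.ball y₀ δ, ∃ x : E, ‖x‖ ≤ n ∧ ‖z - T x‖ < c * δ / 2 := by
    intro z hz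
    obtain ⟨_, ⟨x, hx, rfl⟩, hzx⟩ :=
      Metric.mem_closure_iff.1 (interior_subset (hball hz)) (c * δ / 2) (by positivity)
    exact ⟨x, by simpa using hx, by rwa [← dist_eq_norm]⟩
  obtain ⟨x₁, hx₁, h₁⟩ := approx (y₀ + y) (by simpa using hy)
  obtain ⟨x₂, hx₂, h₂⟩ := approx y₀ (Metric.mem_ball_self hδ)
  refine ⟨x₁ - x₂, (norm_sub_le _ _).trans (add_le_add hx₁ hx₂), ?_⟩
  calc ‖y - T (x₁ - x₂)‖ = ‖(y₀ + y - T x₁) - (y₀ - T x₂)‖ := by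
        rw [map_sub]; congr 1; abel
    _ ≤ ‖y₀ + y - T x₁‖ + ‖y₀ - T x₂‖ := norm_sub_le _ _
    _ < c * δ := by linarith

/-- Approximate preimages at every scale `c ^ n` sum up to exact preimages. -/
lemma exists_preimage_of_approx_preimage {E F : Type*} [NormedAddCommGroup E]
    [NormedAddCommGroup F] [CompleteSpace E] {c δ R : ℝ} (hc0 : 0 < c) (hc1 : c < 1)
    (T : E →+ F) (hTcont : Continuous T)
    (h : ∀ (n : ℕ) (y : F), ‖y‖ < c ^ n * δ →
      ∃ x : E, ‖x‖ ≤ c ^ n * R ∧ ‖y - T x‖ < c ^ (n + 1) * δ)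
    (n : ℕ) (y : F) (hy : ‖y‖ < c ^ n * δ) :
    ∃ x : E, ‖x‖ ≤ c ^ n * (R / (1 - c)) ∧ T x = y := by
  choose! g hgnorm hgapprox using h
  let r : ℕ → F := fun k => Nat.rec y (fun k z => z - T (g (n + k) z)) k
  have hr : ∀ k, ‖r k‖ < c ^ (n + k) * δ := by
    intro k
    induction k with
    | zero => exact hy
    | succ k ih => exact hgapprox (n + k) (r k) ih
  let u : ℕ → E := fun k => g (n + k) (r k)
  have hu : ∀ k, ‖u k‖ ≤ c ^ n * R * c ^ k := fun k =>
    (hgnorm (n + k) (r k) (hr k)).trans_eq (by ring)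
  have hgeom : HasSum (fun k => c ^ n * R * c ^ k) (c ^ n * R * (1 - c)⁻¹) :=
    (hasSum_geometric_of_lt_one hc0.le hc1).mul_left _
  have hsum : Summable u := .of_norm_bounded hgeom.summable hu
  refine ⟨∑' k, u k, (tsum_of_norm_bounded hgeom hu).trans_eq (by ring), ?_⟩
  have hpartial : ∀ k, T (∑ i ∈ Finset.range k, u i) = y - r k := by
    intro k
    induction k with
    | zero => simp [r]
    | succ k ih =>
      rw [Finset.sum_range_succ, map_add, ih]
      change y - r k + T (u k) = y - (r k - T (u k))
      abel
  have hr0 : Tendsto r atTop (𝓝 0) := by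
    refine squeeze_zero_norm (fun k => (hr k).le) ?_
    have := ((tendsto_pow_atTop_nhds_zero_of_lt_one hc0.le hc1).const_mul (c ^ n)).mul_const δ
    simpa [pow_add] using this
  refine tendsto_nhds_unique
    ((hTcont.tendsto _).comp hsum.hasSum.tendsto_sum_nat) ?_
  simpa [Function.comp_def, hpartial] using hr0.const_sub y

/-- Open mapping theorem: let `E`, `F` be complete nonarchimedean normed additive
commutative groups, `0 < c < 1`, and `σ : E ≃+ E`, `τ : F ≃+ F` automorphisms scaling
the norms by `c`. If `T : E →+ F` is a continuous surjective homomorphism with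
`T ∘ σ = τ ∘ T`, then `T` is an open map. -/
theorem stmt8 {E F : Type*} [NormedAddCommGroup E] [NormedAddCommGroup F]
    [CompleteSpace E] [CompleteSpace F]
    (hE : ∀ x y : E, ‖x + y‖ ≤ max ‖x‖ ‖y‖)
    (hF : ∀ x y : F, ‖x + y‖ ≤ max ‖x‖ ‖y‖)
    (c : ℝ) (hc0 : 0 < c) (hc1 : c < 1)
    (σ : E ≃+ E) (τ : F ≃+ F)
    (hσ : ∀ x : E, ‖σ x‖ = c * ‖x‖) (hτ : ∀ y : F, ‖τ y‖ = c * ‖y‖)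
    (T : E →+ F) (hTcont : Continuous T) (hTsurj : Function.Surjective T)
    (hcomm : ∀ x : E, T (σ x) = τ (T x)) :
    IsOpenMap T := by
  obtain ⟨δ, hδ, R, hR⟩ := exists_approx_preimage_of_surjective hc0 T hTsurj
  have happrox : ∀ (n : ℕ) (y : F), ‖y‖ < c ^ n * δ →
      ∃ x : E, ‖x‖ ≤ c ^ n * R ∧ ‖y - T x‖ < c ^ (n + 1) * δ := by
    intro n
    induction n with
    | zero => simpa using hR
    | succ n ih =>
      intro y hy
      obtain ⟨z, rfl⟩ := τ.surjective y
      rw [hτ, pow_succ', mul_assoc, mul_lt_mul_iff_right₀ hc0] at hy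
      obtain ⟨x, hx, hzx⟩ := ih z hy
      refine ⟨σ x, ?_, ?_⟩
      · rw [hσ, pow_succ', mul_assoc]
        gcongr
      · rw [hcomm, ← map_sub, hτ, pow_succ', mul_assoc]
        gcongr
  intro U hU
  rw [Metric.isOpen_iff]
  rintro _ ⟨x, hx, rfl⟩
  obtain ⟨ε, hε, hball⟩ := Metric.isOpen_iff.1 hU x hx
  have hlim : Tendsto (fun n : ℕ => c ^ n * (R / (1 - c))) atTop (𝓝 0) := by
    simpa using (tendsto_pow_atTop_nhds_zero_of_lt_one hc0.le hc1).mul_const (R / (1 - c))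
  obtain ⟨n, hn⟩ := (hlim.eventually_lt_const hε).exists
  refine ⟨c ^ n * δ, by positivity, fun y hy => ?_⟩
  obtain ⟨z, hz, hzy⟩ := exists_preimage_of_approx_preimage hc0 hc1 T hTcont happrox n (y - T x)
    (by rwa [← dist_eq_norm])
  exact ⟨x + z, hball (by simpa using hz.trans_lt hn), by rw [map_add, hzy]; abel⟩
end

section
/- Let R be a reduced commutative ring such that (a) for every maximal ideal 𝔪 of R the localization R_𝔪 is an integral domain and a valuation ring, and (b) the total ring of fractions Q(R) (the localization of R at its set of non-zero-divisors) has Krull dimension ≤ 0. Then an R-module M is flat if and only if M is torsion-free, i.e. for every non-zero-divisor r ∈ R and every x ∈ M, r·x = 0 implies x = 0. -/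
/-- In a reduced commutative ring of Krull dimension at most zero, every element `c`
is von Neumann regular. -/
theorem exists_eq_sq_mul_of_krullDimLE_zero {Q : Type*} [CommRing Q] [IsReduced Q]
    [Ring.KrullDimLE 0 Q] (c : Q) : ∃ q, c = c ^ 2 * q := by
  let S : Submonoid Q :=
    { carrier := {y | ∃ (n : ℕ) (a : Q), y = c ^ n * (1 - c * a)}
      one_mem' := ⟨0, 0, by simp⟩
      mul_mem' := by
        rintro _ _ ⟨n, a, rfl⟩ ⟨k, b, rfl⟩
        exact ⟨n + k, a + b - c * a * b, by ring⟩ }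
  have hzero : (0 : Q) ∈ S := by
    by_contra h
    obtain ⟨p, hp, -, hdisj⟩ := Ideal.exists_le_prime_disjoint ⊥ S
      (Set.disjoint_left.mpr fun x hx hxS ↦ h ((Submodule.mem_bot Q).mp hx ▸ hxS))
    have hcp : c ∉ p := fun hc ↦ Set.disjoint_left.mp hdisj hc ⟨1, 0, by simp⟩
    obtain ⟨a, i, hi, hai⟩ := hp.isMaximal'.exists_inv hcp
    exact Set.disjoint_left.mp hdisj hi ⟨0, a, by linear_combination hai⟩
  obtain ⟨n, a, hna⟩ := hzero
  refine ⟨a, ?_⟩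
  have hnil : c * (1 - c * a) = 0 := IsReduced.eq_zero _
    ⟨n + 1, by rw [mul_pow]; linear_combination -(c * (1 - c * a) ^ n) * hna⟩
  linear_combination hnil

open nonZeroDivisors in
/-- If the total ring of fractions of a reduced ring has Krull dimension at most zero, then
every element `c` is von Neumann regular up to a non-zero-divisor. -/
theorem exists_nonZeroDivisor_mul_eq_sq_mul {R : Type*} [CommRing R] [IsReduced R]
    (hdim : ringKrullDim (FractionRing R) ≤ 0) (c : R) :
    ∃ d ∈ R⁰, ∃ b, d * c = c ^ 2 * b := by
  have : Ring.KrullDimLE 0 (FractionRing R) := Ring.krullDimLE_iff.mpr hdim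
  obtain ⟨q, hq⟩ := exists_eq_sq_mul_of_krullDimLE_zero (algebraMap R (FractionRing R) c)
  obtain ⟨⟨b, d⟩, hbd⟩ := IsLocalization.surj R⁰ q
  refine ⟨d, d.2, b, IsFractionRing.injective R (FractionRing R) ?_⟩
  simp only [map_mul, map_pow] at hbd ⊢
  linear_combination algebraMap R (FractionRing R) d * hq +
    algebraMap R (FractionRing R) c ^ 2 * hbd

/-- Let `R` be a reduced commutative ring such that (a) every localization of `R` at a
maximal ideal is an integral domain and a valuation ring, and (b) the total ring of
fractions of `R` has Krull dimension `≤ 0`. Then an `R`-module `M` is flat if and only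
if it is torsion-free. -/
theorem stmt9 {R : Type*} [CommRing R] [IsReduced R]
    (hloc : ∀ (𝔪 : Ideal R) [𝔪.IsPrime], 𝔪.IsMaximal →
      IsDomain (Localization.AtPrime 𝔪) ∧
        ∀ a b : Localization.AtPrime 𝔪, ∃ c, a * c = b ∨ b * c = a)
    (hdim : ringKrullDim (FractionRing R) ≤ 0)
    (M : Type*) [AddCommGroup M] [Module R M] :
    Module.Flat R M ↔ ∀ r ∈ nonZeroDivisors R, ∀ x : M, r • x = 0 → x = 0 := by
  refine ⟨fun _ r hr x hx ↦ Module.Flat.isSMulRegular_of_nonZeroDivisors hr (by simpa using hx),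
    fun htf ↦ Module.flat_of_localized_maximal _ fun P hP ↦ ?_⟩
  obtain ⟨hdom, hval⟩ := hloc P hP
  have : ValuationRing (Localization P.primeCompl) := { cond' := hval }
  rw [← Module.flat_iff_of_isLocalization (Localization P.primeCompl) P.primeCompl,
    Module.Flat.flat_iff_torsion_eq_bot_of_isBezout, eq_bot_iff]
  rintro y ⟨⟨a, ha⟩, hay⟩
  obtain ⟨⟨r, s⟩, rfl⟩ := IsLocalization.mk'_surjective P.primeCompl a
  obtain ⟨⟨x, t⟩, rfl⟩ := IsLocalizedModule.mk'_surjective P.primeCompl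
    (LocalizedModule.mkLinearMap P.primeCompl M) y
  change IsLocalization.mk' (Localization P.primeCompl) r s •
    IsLocalizedModule.mk' (LocalizedModule.mkLinearMap P.primeCompl M) x t = 0 at hay
  rw [IsLocalizedModule.mk'_smul_mk', IsLocalizedModule.mk'_eq_zero'] at hay
  obtain ⟨u, hu⟩ := hay
  rw [Submonoid.smul_def, smul_smul] at hu
  rw [Submodule.mem_bot]
  change IsLocalizedModule.mk' (LocalizedModule.mkLinearMap P.primeCompl M) x t = 0
  rw [IsLocalizedModule.mk'_eq_zero']
  obtain ⟨d, hd, b, hdb⟩ := exists_nonZeroDivisor_mul_eq_sq_mul hdim (u * r)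
  have hur : algebraMap R (Localization P.primeCompl) (u * r) ≠ 0 := by
    rw [map_mul]
    refine mul_ne_zero (IsLocalization.map_units _ u).ne_zero fun hr ↦ nonZeroDivisors.ne_zero ha ?_
    rw [← IsLocalization.mk'_one (M := P.primeCompl), IsLocalization.mk'_eq_zero_iff] at hr
    exact (IsLocalization.mk'_eq_zero_iff r s).mpr hr
  have he : algebraMap R (Localization P.primeCompl) (d - u * r * b) = 0 := by
    refine (mul_eq_zero.mp ?_).resolve_left hur
    rw [← map_mul, show u * r * (d - u * r * b) = 0 by linear_combination hdb, map_zero]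
  obtain ⟨v, hv⟩ := (IsLocalization.map_eq_zero_iff P.primeCompl _ _).mp he
  refine ⟨v, htf d hd _ ?_⟩
  rw [Submonoid.smul_def, smul_smul, show d * v = v * b * (u * r) by linear_combination hv,
    mul_smul, hu, smul_zero]
end

section
/- Let A be a commutative ring with a ring norm ‖·‖ (so ‖x‖ = 0 iff x = 0 and ‖x·y‖ ≤ ‖x‖·‖y‖). Suppose there exists a constant C ≥ 0 such that every power-bounded element x of A (i.e. one for which the set {‖x^n‖ : n ∈ ℕ} is bounded) satisfies ‖x‖ ≤ C, and suppose there exists an invertible element u ∈ A with ‖u^n‖ → 0 as n → ∞. Then A is reduced. -/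
/-- A nilpotent element of a normed ring is power-bounded. -/
theorem IsNilpotent.bddAbove_range_norm_pow {A : Type*} [NormedRing A] {x : A}
    (hx : IsNilpotent x) : BddAbove (Set.range fun n : ℕ => ‖x ^ n‖) := by
  obtain ⟨k, hk⟩ := hx
  refine (((Set.finite_Iio k).image fun n : ℕ => ‖x ^ n‖).insert 0).bddAbove.mono ?_
  rintro _ ⟨n, rfl⟩
  rcases lt_or_ge n k with h | h
  · exact Or.inr ⟨n, h, rfl⟩
  · exact Or.inl (by simp [pow_eq_zero_of_le h hk])

/-- Let `A` be a commutative ring with a ring norm. If there is a constant `C ≥ 0`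
bounding the norm of every power-bounded element, and there is an invertible element
`u` with `‖u^n‖ → 0`, then `A` is reduced. -/
theorem stmt10 {A : Type*} [NormedCommRing A]
    (C : ℝ) (hC : 0 ≤ C)
    (hpb : ∀ x : A, BddAbove (Set.range fun n : ℕ => ‖x ^ n‖) → ‖x‖ ≤ C)
    (u : A) (hu : IsUnit u)
    (htends : Filter.Tendsto (fun n : ℕ => ‖u ^ n‖) Filter.atTop (nhds 0)) :
    IsReduced A := by
  refine ⟨fun x hx => ?_⟩
  obtain ⟨v, hv⟩ := hu.exists_right_inv
  have hle : ∀ n : ℕ, ‖x‖ ≤ ‖u ^ n‖ * C := fun n =>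
    calc ‖x‖ = ‖u ^ n * (v ^ n * x)‖ := by rw [← mul_assoc, ← mul_pow, hv, one_pow, one_mul]
      _ ≤ ‖u ^ n‖ * ‖v ^ n * x‖ := norm_mul_le _ _
      _ ≤ ‖u ^ n‖ * C := by
        gcongr
        exact hpb _ ((Commute.all _ _).isNilpotent_mul_left hx).bddAbove_range_norm_pow
  have hlim := htends.mul_const C
  rw [zero_mul] at hlim
  exact norm_le_zero_iff.mp (ge_of_tendsto' hlim hle)
end

section
/- Let p be a prime number and let L be the intermediate field of the algebraic closure of ℚ_p over ℚ_p generated by all p-power roots of p, i.e. L = ℚ_p({x : x^{p^n} = p for some n ≥ 1}). Then the ring L ⊗_{ℚ_p} L is not Noetherian. -/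
open scoped TensorProduct

/-- An element `s` of a field extension `L / F` with `1 ⊗ s = s ⊗ 1` in `L ⊗[F] L`
lies in `F`. -/
theorem Algebra.mem_range_of_one_tmul_eq_tmul_one {F L : Type*} [Field F] [Field L]
    [Algebra F L] {s : L} (h : (1 : L) ⊗ₜ[F] s = s ⊗ₜ[F] (1 : L)) :
    s ∈ Set.range (algebraMap F L) := by
  by_contra hs
  have hs' : s ∉ Submodule.span F {(1 : L)} := by
    rw [Submodule.mem_span_singleton]
    rintro ⟨a, rfl⟩
    exact hs ⟨a, Algebra.algebraMap_eq_smul_one a⟩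
  obtain ⟨f, hfs, hf⟩ := Submodule.exists_le_ker_of_notMem hs'
  have hf1 : f 1 = 0 := hf (Submodule.mem_span_singleton_self 1)
  have key := congrArg (fun z => _root_.TensorProduct.rid F L (f.lTensor L z)) h
  simp only [LinearMap.lTensor_tmul, _root_.TensorProduct.rid_tmul, hf1, zero_smul] at key
  exact hfs ((smul_eq_zero.mp key).resolve_right one_ne_zero)

/-- A field extension `L / K` such that `L ⊗[K] L` is Noetherian is finitely generated. -/
theorem IntermediateField.fg_top_of_isNoetherianRing_tensorProduct (K L : Type*) [Field K]
    [Field L] [Algebra K L] [IsNoetherianRing (L ⊗[K] L)] :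
    (⊤ : IntermediateField K L).FG := by
  have hfg : (Ideal.span (Set.range fun s : L => (1 : L) ⊗ₜ[K] s - s ⊗ₜ[K] (1 : L))).FG :=
    IsNoetherian.noetherian _
  obtain ⟨t, ht, hspan⟩ := (Submodule.fg_span_iff_fg_span_finset_subset _).mp hfg
  classical
  obtain ⟨u, rfl⟩ : ∃ u : Finset L,
      u.image (fun s : L => (1 : L) ⊗ₜ[K] s - s ⊗ₜ[K] (1 : L)) = t := by
    rw [← Set.image_univ] at ht
    obtain ⟨u, -, hu⟩ := Finset.subset_set_image_iff.mp ht
    exact ⟨u, hu⟩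
  refine ⟨u, eq_top_iff.mpr fun s _ => ?_⟩
  let F := IntermediateField.adjoin K (u : Set L)
  let φ : L ⊗[K] L →ₐ[K] L ⊗[F] L := Algebra.TensorProduct.productMap
    ((Algebra.TensorProduct.includeLeft : L →ₐ[F] L ⊗[F] L).restrictScalars K)
    ((Algebra.TensorProduct.includeRight : L →ₐ[F] L ⊗[F] L).restrictScalars K)
  have hφ (x : L) : φ ((1 : L) ⊗ₜ[K] x - x ⊗ₜ[K] (1 : L)) = 1 ⊗ₜ[F] x - x ⊗ₜ[F] 1 := by
    simp [φ]
  have hle : Ideal.span (Set.range fun s : L => (1 : L) ⊗ₜ[K] s - s ⊗ₜ[K] (1 : L)) ≤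
      RingHom.ker φ := by
    refine hspan.trans_le (Ideal.span_le.mpr fun y hy => ?_)
    obtain ⟨x, hx, rfl⟩ := Finset.mem_image.mp (Finset.mem_coe.mp hy)
    have hxF : x ∈ F := IntermediateField.subset_adjoin K _ hx
    have hx1 : x = (⟨x, hxF⟩ : F) • (1 : L) := by simp [Algebra.smul_def]
    rw [SetLike.mem_coe, RingHom.mem_ker, hφ, sub_eq_zero, hx1, TensorProduct.tmul_smul,
      TensorProduct.smul_tmul']
  have hs : (1 : L) ⊗ₜ[F] s = s ⊗ₜ[F] (1 : L) := by
    rw [← sub_eq_zero, ← hφ]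
    exact hle (Ideal.subset_span ⟨s, rfl⟩)
  obtain ⟨a, rfl⟩ := Algebra.mem_range_of_one_tmul_eq_tmul_one hs
  exact a.2

/-- If a finite extension of `ℚ_[p]` contains a `p ^ n`-th root of `p`, then `p ^ n` divides
its degree. -/
theorem Padic.pow_dvd_finrank_of_pow_eq {p : ℕ} [Fact p.Prime] {L : Type*} [Field L]
    [Algebra ℚ_[p] L] {n : ℕ} {x : L} (hx : x ^ p ^ n = p) :
    p ^ n ∣ Module.finrank ℚ_[p] L := by
  have h : Algebra.norm ℚ_[p] x ^ p ^ n = (p : ℚ_[p]) ^ Module.finrank ℚ_[p] L := by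
    rw [← map_pow, hx, ← map_natCast (algebraMap ℚ_[p] L), Algebra.norm_algebraMap]
  have hv := congrArg Padic.valuation h
  rw [Padic.valuation_pow, Padic.valuation_pow, Padic.valuation_p, mul_one] at hv
  exact Int.natCast_dvd_natCast.mp ⟨_, hv.symm⟩

/-- Let `p` be a prime and `L = ℚ_p(p^{1/p^∞})` the intermediate field of the algebraic
closure of `ℚ_p` generated over `ℚ_p` by all `p`-power roots of `p`. Then `L ⊗_{ℚ_p} L`
is not Noetherian. -/
theorem stmt14 (p : ℕ) [Fact p.Prime] :
    ¬ IsNoetherianRing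
      ((IntermediateField.adjoin ℚ_[p]
          {x : AlgebraicClosure ℚ_[p] | ∃ n : ℕ, 1 ≤ n ∧
            x ^ p ^ n = (p : AlgebraicClosure ℚ_[p])}) ⊗[ℚ_[p]]
        (IntermediateField.adjoin ℚ_[p]
          {x : AlgebraicClosure ℚ_[p] | ∃ n : ℕ, 1 ≤ n ∧
            x ^ p ^ n = (p : AlgebraicClosure ℚ_[p])})) := by
  intro hN
  set L := IntermediateField.adjoin ℚ_[p]
    {x : AlgebraicClosure ℚ_[p] | ∃ n : ℕ, 1 ≤ n ∧
      x ^ p ^ n = (p : AlgebraicClosure ℚ_[p])}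
  obtain ⟨t, ht⟩ := IntermediateField.fg_top_of_isNoetherianRing_tensorProduct ℚ_[p] L
  have hfin : FiniteDimensional ℚ_[p] L := by
    have := IntermediateField.finiteDimensional_adjoin (K := ℚ_[p]) (S := (t : Set L))
      fun x _ => Algebra.IsIntegral.isIntegral x
    rw [ht] at this
    exact IntermediateField.topEquiv.toLinearEquiv.finiteDimensional
  have hp : p.Prime := Fact.out
  set d := Module.finrank ℚ_[p] L
  have hd : 0 < d := Module.finrank_pos
  obtain ⟨x, hx⟩ := IsAlgClosed.exists_pow_nat_eq (p : AlgebraicClosure ℚ_[p])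
    (pow_pos hp.pos d)
  have hxL : x ∈ L := IntermediateField.subset_adjoin _ _ ⟨d, hd, hx⟩
  have hdvd : p ^ d ∣ d :=
    Padic.pow_dvd_finrank_of_pow_eq (x := (⟨x, hxL⟩ : L)) (Subtype.ext (by simpa using hx))
  exact (Nat.le_of_dvd hd hdvd).not_gt (Nat.lt_pow_self hp.one_lt)
end
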